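/- Suppose a finite family X of nonzero vectors in ℝ^m has a minimal subspace segmentation {X_0, X_1, …, X_K} satisfying the non-intersection condition and such that n(X_k) > (K+1)(r(X_k) − 1) for every k with 1 ≤ k ≤ K. Then any minimal subspace segmentation of X satisfying the non-intersection condition whose number of minimal segments is at most K coincides with {X_0, X_1, …, X_K}. -/

import Mathlib

open Submodule Module Finset

noncomputable section

variable {m : ℕ} {ι : Type*}

/-- The subspace spanned by the subfamily of `x` indexed by `S`. -/
def spanOf (x : ι → EuclideanSpace ℝ (Fin m)) (S : Finset ι) :
    Submodule ℝ (EuclideanSpace ℝ (Fin m)) :=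
  Submodule.span ℝ (x '' (S : Set ι))

/-- The rank `r(X_S)` of the subfamily of `x` indexed by `S`. -/
def rOf (x : ι → EuclideanSpace ℝ (Fin m)) (S : Finset ι) : ℕ :=
  Module.finrank ℝ (spanOf x S)

/-- `X_S` is nondegenerate: every subfamily `X_T`, `T ⊆ S`, has rank `min |T| r(X_S)`. -/
def Nondeg (x : ι → EuclideanSpace ℝ (Fin m)) (S : Finset ι) : Prop :=
  ∀ T ⊆ S, rOf x T = min T.card (rOf x S)

/-- `span(X_S)` is a minimal sample subspace: `n(X_S) > r(X_S)` and `X_S` is nondegenerate. -/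
def IsMinimalSeg (x : ι → EuclideanSpace ℝ (Fin m)) (S : Finset ι) : Prop :=
  rOf x S < S.card ∧ Nondeg x S

/-- `span(X_S)` is pure: the subfamily `X_S` is linearly independent. -/
def IsPureSeg (x : ι → EuclideanSpace ℝ (Fin m)) (S : Finset ι) : Prop :=
  LinearIndependent ℝ (fun i : {a // a ∈ S} => x i.1)

/-- A minimal subspace segmentation (MSS) `{J_0, J_1, …, J_K}` of the index set
(the pure piece `J_0` may be absent, i.e. empty). -/
structure IsMSS (x : ι → EuclideanSpace ℝ (Fin m)) (K : ℕ) (J0 : Finset ι)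
    (P : Fin K → Finset ι) : Prop where
  cover : ∀ i : ι, i ∈ J0 ∨ ∃ k, i ∈ P k
  disj0 : ∀ k, Disjoint J0 (P k)
  disj : ∀ k ℓ, k ≠ ℓ → Disjoint (P k) (P ℓ)
  pure0 : IsPureSeg x J0
  minimal : ∀ k, IsMinimalSeg x (P k)
  distinct : ∀ k ℓ, k ≠ ℓ → spanOf x (P k) ≠ spanOf x (P ℓ)
  distinct0 : J0.Nonempty → ∀ k, spanOf x J0 ≠ spanOf x (P k)
  sep0 : ∀ j ∈ J0, ∀ k, x j ∉ spanOf x (P k)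

/-- The non-intersection condition: no sample lies in the intersection of the spans of
two distinct pieces of the segmentation `{J_0, J_1, …, J_K}`. -/
def NonIntersectM (x : ι → EuclideanSpace ℝ (Fin m)) {K : ℕ} (J0 : Finset ι)
    (P : Fin K → Finset ι) : Prop :=
  (∀ (j : ι) (k ℓ : Fin K), k ≠ ℓ → x j ∉ spanOf x (P k) ⊓ spanOf x (P ℓ)) ∧
    (∀ (j : ι) (k : Fin K), x j ∉ spanOf x J0 ⊓ spanOf x (P k))

theorem spanOf_mono (x : ι → EuclideanSpace ℝ (Fin m)) {S T : Finset ι} (h : S ⊆ T) :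
    spanOf x S ≤ spanOf x T :=
  Submodule.span_mono (Set.image_mono (by exact_mod_cast h))

theorem mem_spanOf (x : ι → EuclideanSpace ℝ (Fin m)) {S : Finset ι} {j : ι} (h : j ∈ S) :
    x j ∈ spanOf x S :=
  Submodule.subset_span ⟨j, h, rfl⟩

/-- In a nondegenerate family, a subfamily with at least as many vectors as the rank spans
the whole span. -/
theorem Nondeg.spanOf_eq {x : ι → EuclideanSpace ℝ (Fin m)} {S T : Finset ι} (h : Nondeg x S)
    (hT : T ⊆ S) (hr : rOf x S ≤ T.card) : spanOf x T = spanOf x S :=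
  Submodule.eq_of_le_of_finrank_eq (spanOf_mono x hT) ((h T hT).trans (min_eq_right hr))

theorem IsPureSeg.rOf_eq_card {x : ι → EuclideanSpace ℝ (Fin m)} {S : Finset ι}
    (h : IsPureSeg x S) : rOf x S = S.card := by
  have h1 := finrank_span_eq_card h
  have h2 : Set.range (fun i : {a // a ∈ S} => x i.1) = x '' (S : Set ι) := by
    ext v; simp
  rw [h2] at h1
  exact h1.trans (Fintype.card_coe S)

theorem IsPureSeg.mono {x : ι → EuclideanSpace ℝ (Fin m)} {S T : Finset ι}
    (h : IsPureSeg x S) (hT : T ⊆ S) : IsPureSeg x T :=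
  h.comp (fun i : {a // a ∈ T} => (⟨i.1, hT i.2⟩ : {a // a ∈ S}))
    fun _ _ hab => Subtype.ext (congrArg (fun i => i.1) hab)

section Segmentation

variable {x : ι → EuclideanSpace ℝ (Fin m)} {K : ℕ} {J0 : Finset ι} {P : Fin K → Finset ι}

/-- Under the non-intersection condition a minimal segment contains every sample in its span. -/
theorem IsMSS.mem_of_mem_spanOf (h : IsMSS x K J0 P) (hni : NonIntersectM x J0 P) {j : ι}
    {k : Fin K} (hj : x j ∈ spanOf x (P k)) : j ∈ P k := by
  rcases h.cover j with h0 | ⟨l, hl⟩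
  · exact absurd hj (h.sep0 j h0 k)
  · by_cases hlk : l = k
    · exact hlk ▸ hl
    · exact absurd ⟨mem_spanOf x hl, hj⟩ (hni.1 j l k hlk)

/-- Under the non-intersection condition the pure piece contains every sample in its span. -/
theorem IsMSS.mem_pure_of_mem_spanOf (h : IsMSS x K J0 P) (hni : NonIntersectM x J0 P) {j : ι}
    (hj : x j ∈ spanOf x J0) : j ∈ J0 := by
  rcases h.cover j with h0 | ⟨l, hl⟩
  · exact h0
  · exact absurd ⟨hj, mem_spanOf x hl⟩ (hni.2 j l)

theorem IsMSS.mem_pure_iff (h : IsMSS x K J0 P) (j : ι) : j ∈ J0 ↔ ∀ k, j ∉ P k := by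
  refine ⟨fun hj k hk => Finset.disjoint_left.1 (h.disj0 k) hj hk, fun hj => ?_⟩
  rcases h.cover j with h0 | ⟨l, hl⟩
  · exact h0
  · exact absurd hl (hj l)

/-- A minimal sample subspace with sufficiently many samples has all its samples in a single
minimal segment of any segmentation satisfying the non-intersection condition. -/
theorem IsMSS.exists_subset (h : IsMSS x K J0 P) (hni : NonIntersectM x J0 P) {S : Finset ι}
    (hS : IsMinimalSeg x S) (hfat : (K + 1) * (rOf x S - 1) < S.card) : ∃ k, S ⊆ P k := by
  let piece : Option (Fin K) → Finset ι := fun o => o.elim J0 P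
  have hcov : ∀ i, ∃ o, i ∈ piece o := fun i =>
    (h.cover i).elim (fun h0 => ⟨none, h0⟩) fun ⟨k, hk⟩ => ⟨some k, hk⟩
  choose g hg using hcov
  obtain ⟨o, -, ho⟩ := Finset.exists_lt_card_fiber_of_mul_lt_card_of_maps_to
    (s := S) (t := (Finset.univ : Finset (Option (Fin K)))) (f := g) (n := rOf x S - 1)
    (fun _ _ => Finset.mem_univ _) (by simpa using hfat)
  have hsub : S.filter (fun i => g i = o) ⊆ piece o := fun i hi =>
    (Finset.mem_filter.1 hi).2 ▸ hg i
  have hle : spanOf x S ≤ spanOf x (piece o) :=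
    (hS.2.spanOf_eq (Finset.filter_subset _ S) (by omega)).ge.trans (spanOf_mono x hsub)
  cases o with
  | some k => exact ⟨k, fun j hj => h.mem_of_mem_spanOf hni (hle (mem_spanOf x hj))⟩
  | none =>
    have hSJ : S ⊆ J0 := fun j hj => h.mem_pure_of_mem_spanOf hni (hle (mem_spanOf x hj))
    exact absurd (h.pure0.mono hSJ).rOf_eq_card hS.1.ne

end Segmentation

/-- A minimal sample subspace contained in a nondegenerate family spans the same subspace. -/
theorem IsMinimalSeg.spanOf_eq_of_subset {x : ι → EuclideanSpace ℝ (Fin m)} {S T : Finset ι}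
    (hS : IsMinimalSeg x S) (hT : Nondeg x T) (h : S ⊆ T) : spanOf x S = spanOf x T := by
  have h1 := hT S h
  have h2 := hS.1
  exact hT.spanOf_eq h (by omega)


/-- A "fat" MSS satisfying the non-intersection condition is unique among
the MSSs satisfying the non-intersection condition with at most as many minimal segments. -/
theorem mss_unique_of_fat [Fintype ι]
    (x : ι → EuclideanSpace ℝ (Fin m)) (hx : ∀ j, x j ≠ 0)
    {K : ℕ} {J0 : Finset ι} {P : Fin K → Finset ι}
    (hmss : IsMSS x K J0 P) (hni : NonIntersectM x J0 P)
    (hfat : ∀ k, (K + 1) * (rOf x (P k) - 1) < (P k).card)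
    {K' : ℕ} {J0' : Finset ι} {P' : Fin K' → Finset ι}
    (hmss' : IsMSS x K' J0' P') (hni' : NonIntersectM x J0' P')
    (hK' : K' ≤ K) :
    J0' = J0 ∧ ∃ e : Fin K' ≃ Fin K, ∀ k', P (e k') = P' k' := by
  have hex : ∀ k, ∃ k', P k ⊆ P' k' := fun k =>
    hmss'.exists_subset hni' (hmss.minimal k)
      ((Nat.mul_le_mul_right _ (by omega)).trans_lt (hfat k))
  choose f hf using hex
  have hspan : ∀ k, spanOf x (P k) = spanOf x (P' (f k)) := fun k =>
    (hmss.minimal k).spanOf_eq_of_subset (hmss'.minimal (f k)).2 (hf k)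
  have hinj : Function.Injective f := fun k l hkl => by
    by_contra hne
    exact hmss.distinct k l hne (by rw [hspan k, hspan l, hkl])
  have hbij : Function.Bijective f :=
    (Fintype.bijective_iff_injective_and_card f).2
      ⟨hinj, le_antisymm (Fintype.card_le_of_injective f hinj) (by simpa using hK')⟩
  have heq : ∀ k, P k = P' (f k) := fun k =>
    (hf k).antisymm fun j hj =>
      hmss.mem_of_mem_spanOf hni (hspan k ▸ mem_spanOf x hj)
  refine ⟨?_, (Equiv.ofBijective f hbij).symm, fun k' => ?_⟩
  · ext j
    simp only [hmss.mem_pure_iff, hmss'.mem_pure_iff, heq]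
    exact (hbij.2.forall (p := fun k' => j ∉ P' k'))
  · rw [heq]
    exact congrArg P' ((Equiv.ofBijective f hbij).apply_symm_apply k')
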